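/- arXiv:1504.04690 — 9 statements merged into one kernel-verified Lean document; each statement's English description precedes it below -/
import Mathlib

section
/- Let (X, dist) be a pseudometric space, let v ∈ X, let Q and C be subsets of X, and let ℓ : X → ℝ be a length function with ℓ(q*) ≥ 0 for every q* ∈ C. Let ε be a real number with 0 < ε ≤ 1/2. If C is a quasi-ε-covering of Q with respect to v (for every q ∈ Q there is q* ∈ C with ℓ(q*) + dist(q*, q) ≤ dist(v, q) + ε·ℓ(q*)), then C is a 2ε-covering of Q with respect to v (for every q ∈ Q there is q* ∈ C with ℓ(q*) + dist(q*, q) ≤ (1 + 2ε)·dist(v, q)). -/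
theorem quasi_covering_is_two_eps_covering
    {X : Type*} [PseudoMetricSpace X]
    (v : X) (Q C : Set X) (ℓ : X → ℝ) (ε : ℝ)
    (hℓ : ∀ qstar ∈ C, 0 ≤ ℓ qstar)
    (hε0 : 0 < ε) (hε1 : ε ≤ 1 / 2)
    (hquasi : ∀ q ∈ Q, ∃ qstar ∈ C,
      ℓ qstar + dist qstar q ≤ dist v q + ε * ℓ qstar) :
    ∀ q ∈ Q, ∃ qstar ∈ C,
      ℓ qstar + dist qstar q ≤ (1 + 2 * ε) * dist v q := by
  intro q hq
  obtain ⟨c, hc, h⟩ := hquasi q hq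
  refine ⟨c, hc, ?_⟩
  have h1 : ε * ℓ c ≤ 1 / 2 * ℓ c := mul_le_mul_of_nonneg_right hε1 (hℓ c hc)
  have h0 : 0 ≤ dist c q := dist_nonneg
  have h2 : ℓ c ≤ 2 * dist v q := by linarith
  have h3 : ε * ℓ c ≤ ε * (2 * dist v q) := mul_le_mul_of_nonneg_left h2 hε0.le
  linarith
end

section
/- Let (X, dist) be a pseudometric space, let ε ≥ 0, and let u, w, q ∈ X satisfy dist(u, q) + dist(q, w) = dist(u, w) (a shortest u-to-w path passes through q). Let C_u, C_w ⊆ X and let ℓ_u, ℓ_w : X → ℝ satisfy ℓ_u(c) ≥ dist(u, c) for all c ∈ C_u and ℓ_w(c') ≥ dist(w, c') for all c' ∈ C_w. Suppose there exists c ∈ C_u with ℓ_u(c) + dist(c, q) ≤ (1+ε)·dist(u, q), and there exists c' ∈ C_w with ℓ_w(c') + dist(c', q) ≤ (1+ε)·dist(w, q). Then: (i) for all c ∈ C_u and c' ∈ C_w, ℓ_u(c) + dist(c, c') + ℓ_w(c') ≥ dist(u, w); and (ii) there exist c ∈ C_u and c' ∈ C_w with ℓ_u(c) + dist(c, c') +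 ℓ_w(c') ≤ (1+ε)·dist(u, w). -/
theorem connections_query_correctness
    {X : Type*} [PseudoMetricSpace X]
    (ε : ℝ) (hε : 0 ≤ ε)
    (u w q : X)
    (hq : dist u q + dist q w = dist u w)
    (Cu Cw : Set X) (ℓu ℓw : X → ℝ)
    (hℓu : ∀ c ∈ Cu, dist u c ≤ ℓu c)
    (hℓw : ∀ c' ∈ Cw, dist w c' ≤ ℓw c')
    (hcu : ∃ c ∈ Cu, ℓu c + dist c q ≤ (1 + ε) * dist u q)
    (hcw : ∃ c' ∈ Cw, ℓw c' + dist c' q ≤ (1 + ε) * dist w q) :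
    (∀ c ∈ Cu, ∀ c' ∈ Cw, dist u w ≤ ℓu c + dist c c' + ℓw c') ∧
    (∃ c ∈ Cu, ∃ c' ∈ Cw, ℓu c + dist c c' + ℓw c' ≤ (1 + ε) * dist u w) := by
  constructor
  · intro c hc c' hc'
    have h1 := hℓu c hc
    have h2 := hℓw c' hc'
    have h3 := dist_triangle4 u c c' w
    rw [dist_comm c' w] at h3
    linarith
  · obtain ⟨c, hc, h1⟩ := hcu
    obtain ⟨c', hc', h2⟩ := hcw
    refine ⟨c, hc, c', hc', ?_⟩
    have h3 := dist_triangle c q c'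
    rw [dist_comm q c'] at h3
    rw [dist_comm w q] at h2
    rw [← hq, mul_add]
    linarith
end

section
/- Let (X, dist) be a pseudometric space, let ε₀, ε₁ be real numbers with ε₀ ≥ 0 and 0 ≤ ε₁ ≤ 1, let v, q, d, c ∈ X, and let ℓ_d, ℓ_c be real numbers with ℓ_d ≥ 0. If dist(q, d) + ℓ_d ≤ (1+ε₀)·dist(v, q) (d ε₀-covers q with respect to v) and dist(d, c) + ℓ_c ≤ (1+ε₁)·ℓ_d (c semi-ε₁-covers d), then dist(q, c) + ℓ_c ≤ (1 + 2ε₀ + ε₁)·dist(v, q) (c (2ε₀+ε₁)-covers q with respect to v). -/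
theorem thinning_correctness_step
    {X : Type*} [PseudoMetricSpace X]
    (ε₀ ε₁ : ℝ) (hε₀ : 0 ≤ ε₀) (hε₁0 : 0 ≤ ε₁) (hε₁1 : ε₁ ≤ 1)
    (v q d c : X) (ℓd ℓc : ℝ) (hℓd : 0 ≤ ℓd)
    (hcover : dist q d + ℓd ≤ (1 + ε₀) * dist v q)
    (hsemi : dist d c + ℓc ≤ (1 + ε₁) * ℓd) :
    dist q c + ℓc ≤ (1 + (2 * ε₀ + ε₁)) * dist v q := by
  have h1 := dist_triangle q d c
  have h2 : 0 ≤ ε₁ * dist q d := mul_nonneg hε₁0 dist_nonneg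
  have h3 := mul_le_mul_of_nonneg_left hcover (by linarith : (0:ℝ) ≤ 1 + ε₁)
  have h4 : 0 ≤ (1 - ε₁) * (ε₀ * dist v q) :=
    mul_nonneg (by linarith) (mul_nonneg hε₀ dist_nonneg)
  nlinarith
end

section
/- Let (X, dist) be a pseudometric space and let Q ⊆ X be a finite set with a map x : Q → ℝ such that dist(q, q') = |x(q) − x(q')| for all q, q' ∈ Q. Let ε₀, ε₁ be real numbers with ε₀ ≥ 0 and 0 < ε₁ ≤ 1. Let v ∈ X satisfy dist(v, q) > 0 for all q ∈ Q, let D ⊆ Q, and let ℓ : Q → ℝ satisfy ℓ(d) ≥ dist(v, d) for all d ∈ D. Suppose D is an ε₀-covering of Q with respect to v: for every q ∈ Q there is d ∈ D with ℓ(d) + dist(d, q) ≤ (1+ε₀)·dist(v, q). Then there exists C ⊆ D such that C is a (2ε₀+ε₁)-covering of Q with respect to v (for every q ∈ Q there is c ∈ C with ℓ(c) + dist(c, q) ≤ (1 + 2ε₀ + ε₁)·dist(v, q)) and the cardinality of C is at most 2·(1 + (2+ε₀)/ε₁). -/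
theorem thin_side
    {X : Type*} [PseudoMetricSpace X]
    (Q : Finset X) (x : X → ℝ)
    (hx : ∀ q ∈ Q, ∀ q' ∈ Q, dist q q' = |x q - x q'|)
    (ε₀ ε₁ : ℝ) (hε₀ : 0 ≤ ε₀) (hε₁0 : 0 < ε₁)
    (v : X)
    (D : Finset X) (ℓ : X → ℝ)
    (hcover : ∀ q ∈ Q, ∃ d ∈ D, ℓ d + dist d q ≤ (1 + ε₀) * dist v q)
    (q0 : X) (hq0 : q0 ∈ Q) (hmin : ∀ q ∈ Q, dist v q0 ≤ dist v q) (n : ℕ) :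
    ∀ c ∈ D, ∀ p ∈ Q, x q0 ≤ x p →
      ℓ c + dist c p - x p < - dist v q0 - x q0 + (n + 1) * (ε₁ * dist v q0) →
      ∃ C : Finset X, C ⊆ D ∧
      (∀ q ∈ Q, x p ≤ x q → ∃ c ∈ C, ℓ c + dist c q ≤ (1 + (2 * ε₀ + ε₁)) * dist v q) ∧
      C.card ≤ n + 1 := by
  classical
  have step : ∀ c, ∀ p ∈ Q, ∀ q ∈ Q, x p ≤ x q →
      ℓ c + dist c q - x q ≤ ℓ c + dist c p - x p := by
    intro c p hp q hq h
    have h1 := dist_triangle c p q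
    rw [hx p hp q hq, abs_sub_comm, abs_of_nonneg (by linarith)] at h1
    linarith
  induction n with
  | zero =>
    intro c hc p hp h0 h
    refine ⟨{c}, by simpa using hc, ?_, by simp⟩
    intro q hq hpq
    refine ⟨c, by simp, ?_⟩
    have h1 := step c p hp q hq hpq
    have h2 := dist_triangle q v q0
    rw [hx q hq q0 hq0, abs_of_nonneg (by linarith), dist_comm q v] at h2
    have h3 := mul_le_mul_of_nonneg_left (hmin q hq) hε₁0.le
    have h4 : 0 ≤ ε₀ * dist v q := mul_nonneg hε₀ dist_nonneg
    push_cast at h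
    linarith
  | succ n ih =>
    intro c hc p hp h0 h
    set B := Q.filter (fun q => x p ≤ x q ∧
      ¬ ℓ c + dist c q ≤ (1 + (2 * ε₀ + ε₁)) * dist v q) with hB
    rcases B.eq_empty_or_nonempty with he | hne
    · refine ⟨{c}, by simpa using hc, ?_, by simp⟩
      intro q hq hpq
      refine ⟨c, by simp, ?_⟩
      by_contra hcon
      have : q ∈ B := Finset.mem_filter.2 ⟨hq, hpq, hcon⟩
      simp [he] at this
    · obtain ⟨q, hqB, hqm⟩ := B.exists_min_image x hne
      obtain ⟨hq, hpq, hnc⟩ := Finset.mem_filter.1 hqB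
      obtain ⟨c', hc', hcov⟩ := hcover q hq
      have h1 := step c p hp q hq hpq
      have h3 := mul_le_mul_of_nonneg_left (hmin q hq) hε₁0.le
      have h4 : 0 ≤ ε₀ * dist v q := mul_nonneg hε₀ dist_nonneg
      push_cast at h
      obtain ⟨C, hCD, hC, hcard⟩ := ih c' hc' q hq (h0.trans hpq) (by
        push_neg at hnc
        linarith)
      refine ⟨insert c C, Finset.insert_subset hc hCD, ?_,
        (Finset.card_insert_le _ _).trans (by omega)⟩
      intro r hr hpr
      by_cases hrq : x q ≤ x r
      · obtain ⟨d, hd, hh⟩ := hC r hr hrq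
        exact ⟨d, Finset.mem_insert_of_mem hd, hh⟩
      · refine ⟨c, Finset.mem_insert_self _ _, ?_⟩
        by_contra hcon
        exact hrq (hqm r (Finset.mem_filter.2 ⟨hr, hpr, hcon⟩))

theorem thinning_lemma
    {X : Type*} [PseudoMetricSpace X]
    (Q : Finset X) (x : X → ℝ)
    (hx : ∀ q ∈ Q, ∀ q' ∈ Q, dist q q' = |x q - x q'|)
    (ε₀ ε₁ : ℝ) (hε₀ : 0 ≤ ε₀) (hε₁0 : 0 < ε₁) (hε₁1 : ε₁ ≤ 1)
    (v : X) (hv : ∀ q ∈ Q, 0 < dist v q)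
    (D : Finset X) (hD : D ⊆ Q)
    (ℓ : X → ℝ) (hℓ : ∀ d ∈ D, dist v d ≤ ℓ d)
    (hcover : ∀ q ∈ Q, ∃ d ∈ D, ℓ d + dist d q ≤ (1 + ε₀) * dist v q) :
    ∃ C : Finset X, C ⊆ D ∧
      (∀ q ∈ Q, ∃ c ∈ C, ℓ c + dist c q ≤ (1 + (2 * ε₀ + ε₁)) * dist v q) ∧
      (C.card : ℝ) ≤ 2 * (1 + (2 + ε₀) / ε₁) := by
  classical
  have hpos : 0 ≤ (2 + ε₀) / ε₁ := by positivity
  rcases Q.eq_empty_or_nonempty with he | hne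
  · refine ⟨∅, by simp, by simp [he], ?_⟩
    simp only [Finset.card_empty, Nat.cast_zero]
    linarith
  obtain ⟨q0, hq0, hmin⟩ := Q.exists_min_image (fun q => dist v q) hne
  obtain ⟨c, hc, hcov⟩ := hcover q0 hq0
  have hfl := Nat.floor_le hpos
  have hlt := Nat.lt_floor_add_one ((2 + ε₀) / ε₁)
  set n := ⌊(2 + ε₀) / ε₁⌋₊
  rw [div_lt_iff₀ hε₁0] at hlt
  have h5 := mul_lt_mul_of_pos_right hlt (hv q0 hq0)
  obtain ⟨C₁, h1, h2, h3⟩ := thin_side Q x hx ε₀ ε₁ hε₀ hε₁0 v D ℓ hcover q0 hq0 hmin n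
    c hc q0 hq0 le_rfl (by linarith)
  obtain ⟨C₂, k1, k2, k3⟩ := thin_side Q (fun q => - x q)
    (by
      intro q hq q' hq'
      rw [hx q hq q' hq', abs_sub_comm]
      congr 1
      ring) ε₀ ε₁ hε₀ hε₁0 v D ℓ hcover q0 hq0 hmin n
    c hc q0 hq0 le_rfl (by linarith)
  refine ⟨C₁ ∪ C₂, Finset.union_subset h1 k1, ?_, ?_⟩
  · intro q hq
    rcases le_total (x q0) (x q) with h | h
    · obtain ⟨d, hd, hh⟩ := h2 q hq h
      exact ⟨d, Finset.mem_union_left _ hd, hh⟩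
    · obtain ⟨d, hd, hh⟩ := k2 q hq (neg_le_neg h)
      exact ⟨d, Finset.mem_union_right _ hd, hh⟩
  · have h6 : (C₁ ∪ C₂).card ≤ 2 * (1 + n) := (Finset.card_union_le _ _).trans (by omega)
    have h7 : ((C₁ ∪ C₂).card : ℝ) ≤ 2 * (1 + n) := by exact_mod_cast h6
    linarith
end

section
/- Let (X, dist) be a pseudometric space and let Q ⊆ X be a finite set with a map x : Q → ℝ such that dist(q, q') = |x(q) − x(q')| for all q, q' ∈ Q. Let ε > 0 be a real number and let v ∈ X. Then there exists C ⊆ Q with cardinality at most 2·(1 + 2/ε) such that for every q ∈ Q there is c ∈ C with dist(v, c) + dist(c, q) ≤ (1+ε)·dist(v, q). -/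
theorem eps_cov_side
    {X : Type*} [PseudoMetricSpace X]
    (S : Finset X) (x : X → ℝ)
    (hx : ∀ q ∈ S, ∀ q' ∈ S, dist q q' = |x q - x q'|)
    (ε : ℝ) (hε : 0 < ε) (v q0 : X) (hq0 : q0 ∈ S) (h0 : 0 < dist v q0)
    (hmin : ∀ q ∈ S, dist v q0 ≤ dist v q) (hr : ∀ q ∈ S, x q0 ≤ x q) :
    ∃ C : Finset X, C ⊆ S ∧ (C.card : ℝ) ≤ 1 + 2 / ε ∧
      ∀ q ∈ S, ∃ c ∈ C, dist v c + dist c q ≤ (1 + ε) * dist v q := by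
  classical
  set d0 := dist v q0 with hd0
  have hεd : 0 < ε * d0 := mul_pos hε h0
  let j : X → ℕ := fun q => ⌊(x q - dist v q - x q0 + d0) / (ε * d0)⌋₊
  have hnn : ∀ q ∈ S, 0 ≤ (x q - dist v q - x q0 + d0) / (ε * d0) := by
    intro q hq
    have h1 := dist_triangle v q0 q
    rw [hx q0 hq0 q hq, abs_sub_comm, abs_of_nonneg (sub_nonneg.2 (hr q hq))] at h1
    apply div_nonneg _ hεd.le
    linarith
  have hub : ∀ q ∈ S, (x q - dist v q - x q0 + d0) / (ε * d0) ≤ 2 / ε := by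
    intro q hq
    have h1 := dist_triangle_left q0 q v
    rw [hx q0 hq0 q hq, abs_sub_comm, abs_of_nonneg (sub_nonneg.2 (hr q hq))] at h1
    rw [div_le_div_iff₀ hεd hε]
    nlinarith
  have hch : ∀ k : ℕ, ∃ c : X, k ∈ S.image j →
      c ∈ S ∧ j c = k ∧ ∀ q ∈ S, j q = k → x c ≤ x q := by
    intro k
    by_cases hk : k ∈ S.image j
    · obtain ⟨a, ha, hak⟩ := Finset.mem_image.1 hk
      obtain ⟨c, hc, hm⟩ := Finset.exists_min_image (S.filter (fun q => j q = k)) x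
        ⟨a, Finset.mem_filter.2 ⟨ha, hak⟩⟩
      rw [Finset.mem_filter] at hc
      exact ⟨c, fun _ => ⟨hc.1, hc.2, fun q hq hqk => hm q (Finset.mem_filter.2 ⟨hq, hqk⟩)⟩⟩
    · exact ⟨q0, fun h => absurd h hk⟩
  choose c hc using hch
  refine ⟨(S.image j).image c, ?_, ?_, ?_⟩
  · intro a ha
    obtain ⟨k, hk, rfl⟩ := Finset.mem_image.1 ha
    exact (hc k hk).1
  · have h1 : S.image j ⊆ Finset.range (⌊2 / ε⌋₊ + 1) := by
      intro k hk
      obtain ⟨a, ha, rfl⟩ := Finset.mem_image.1 hk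
      exact Finset.mem_range.2 (Nat.lt_succ_of_le (Nat.floor_le_floor (hub a ha)))
    have h2 := (Finset.card_image_le (s := S.image j) (f := c)).trans (Finset.card_le_card h1)
    rw [Finset.card_range] at h2
    have h3 : (((S.image j).image c).card : ℝ) ≤ (⌊2 / ε⌋₊ : ℝ) + 1 := by exact_mod_cast h2
    have h4 := Nat.floor_le (show 0 ≤ 2 / ε by positivity)
    linarith
  · intro q hq
    have hk := Finset.mem_image_of_mem j hq
    obtain ⟨hcS, hcj, hcm⟩ := hc _ hk
    refine ⟨c (j q), Finset.mem_image_of_mem c hk, ?_⟩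
    have hle := hcm q hq rfl
    generalize c (j q) = p at *
    rw [hx p hcS q hq, abs_sub_comm, abs_of_nonneg (sub_nonneg.2 hle)]
    have h1 := Nat.floor_le (hnn p hcS)
    have h2 := Nat.lt_floor_add_one ((x q - dist v q - x q0 + d0) / (ε * d0))
    have h3 : ((j p : ℕ) : ℝ) = (j q : ℕ) := by rw [hcj]
    simp only [j] at h3
    rw [← h3] at h2
    have h4 : (x q - dist v q - x q0 + d0) / (ε * d0)
        < (x p - dist v p - x q0 + d0) / (ε * d0) + 1 := by linarith
    rw [div_add_one hεd.ne', div_lt_div_iff_of_pos_right hεd] at h4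
    have h5 := mul_le_mul_of_nonneg_left (hmin q hq) hε.le
    linarith

theorem eps_covering_exists
    {X : Type*} [PseudoMetricSpace X]
    (Q : Finset X) (x : X → ℝ)
    (hx : ∀ q ∈ Q, ∀ q' ∈ Q, dist q q' = |x q - x q'|)
    (ε : ℝ) (hε : 0 < ε) (v : X) :
    ∃ C : Finset X, C ⊆ Q ∧ (C.card : ℝ) ≤ 2 * (1 + 2 / ε) ∧
      ∀ q ∈ Q, ∃ c ∈ C, dist v c + dist c q ≤ (1 + ε) * dist v q := by
  classical
  have hpos : 0 < 2 / ε := by positivity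
  rcases Q.eq_empty_or_nonempty with rfl | hne
  · exact ⟨∅, by simp, by simp; positivity, by simp⟩
  obtain ⟨q0, hq0, hmin⟩ := Finset.exists_min_image Q (fun q => dist v q) hne
  rcases (dist_nonneg (x := v) (y := q0)).eq_or_lt with h0 | h0
  · refine ⟨{q0}, by simpa using hq0, by simp; linarith, fun q hq => ⟨q0, by simp, ?_⟩⟩
    have h1 := dist_triangle_left q0 q v
    have h2 := mul_nonneg hε.le (dist_nonneg (x := v) (y := q))
    linarith
  obtain ⟨C1, s1, k1, c1⟩ := eps_cov_side (Q.filter (fun q => x q0 ≤ x q)) x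
    (fun q hq q' hq' => hx q (Finset.mem_filter.1 hq).1 q' (Finset.mem_filter.1 hq').1)
    ε hε v q0 (by simp [hq0]) h0 (fun q hq => hmin q (Finset.mem_filter.1 hq).1)
    (fun q hq => (Finset.mem_filter.1 hq).2)
  obtain ⟨C2, s2, k2, c2⟩ := eps_cov_side (Q.filter (fun q => x q ≤ x q0)) (fun q => - x q)
    (fun q hq q' hq' => by
      rw [hx q (Finset.mem_filter.1 hq).1 q' (Finset.mem_filter.1 hq').1, abs_sub_comm]
      congr 1; ring)
    ε hε v q0 (by simp [hq0]) h0 (fun q hq => hmin q (Finset.mem_filter.1 hq).1)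
    (fun q hq => neg_le_neg (Finset.mem_filter.1 hq).2)
  refine ⟨C1 ∪ C2, Finset.union_subset (s1.trans (Finset.filter_subset _ _))
    (s2.trans (Finset.filter_subset _ _)), ?_, fun q hq => ?_⟩
  · have h : ((C1 ∪ C2).card : ℝ) ≤ C1.card + C2.card := by
      exact_mod_cast Finset.card_union_le C1 C2
    linarith
  · rcases le_total (x q0) (x q) with h | h
    · obtain ⟨c, hc, h'⟩ := c1 q (Finset.mem_filter.2 ⟨hq, h⟩)
      exact ⟨c, Finset.mem_union_left _ hc, h'⟩
    · obtain ⟨c, hc, h'⟩ := c2 q (Finset.mem_filter.2 ⟨hq, h⟩)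
      exact ⟨c, Finset.mem_union_right _ hc, h'⟩
end

section
/- Let (X, dist) be a pseudometric space, let I be a finite nonempty index set, let u : I → X be a family of vertices, let Q ⊆ X, and let ε ≥ 0. For each i ∈ I let C_i ⊆ Q and ℓ_i : Q → ℝ satisfy ℓ_i(c) ≥ dist(u(i), c) for all c ∈ Q, and suppose each C_i is an ε-covering of Q with respect to u(i): for every q ∈ Q there is c ∈ C_i with ℓ_i(c) + dist(c, q) ≤ (1+ε)·dist(u(i), q). Define ℓ(c) = min over i ∈ I of ℓ_i(c). Then: (i) ℓ(c) ≥ min over i ∈ I of dist(u(i), c) for every c ∈ Q; and (ii) for every q ∈ Q there exists c in the union of the C_i with ℓ(c) + dist(c, q) ≤ (1+ε)·(min over i ∈ I of dist(u(i), q)). -/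
theorem extended_thinning_correctness
    {X : Type*} [PseudoMetricSpace X]
    {I : Type*} [Fintype I] [Nonempty I]
    (u : I → X) (Q : Set X) (ε : ℝ) (hε : 0 ≤ ε)
    (C : I → Set X) (hC : ∀ i, C i ⊆ Q)
    (ℓ : I → X → ℝ)
    (hℓ : ∀ i, ∀ c ∈ Q, dist (u i) c ≤ ℓ i c)
    (hcover : ∀ i, ∀ q ∈ Q, ∃ c ∈ C i,
      ℓ i c + dist c q ≤ (1 + ε) * dist (u i) q) :
    (∀ c ∈ Q, (⨅ i, dist (u i) c) ≤ ⨅ i, ℓ i c) ∧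
    (∀ q ∈ Q, ∃ c ∈ ⋃ i, C i,
      (⨅ i, ℓ i c) + dist c q ≤ (1 + ε) * ⨅ i, dist (u i) q) := by
  refine ⟨fun c hc => ?_, fun q hq => ?_⟩
  · exact ciInf_mono (Set.finite_range _).bddBelow (fun i => hℓ i c hc)
  · obtain ⟨i, hi⟩ := exists_eq_ciInf_of_finite (f := fun i => dist (u i) q)
    obtain ⟨c, hc, h⟩ := hcover i q hq
    refine ⟨c, Set.mem_iUnion.2 ⟨i, hc⟩, ?_⟩
    have h1 : (⨅ i, ℓ i c) ≤ ℓ i c := ciInf_le (Set.finite_range _).bddBelow i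
    rw [← hi]
    linarith
end

section
/- Let (X, dist) be a pseudometric space and let Q ⊆ X be a finite set with a map x : Q → ℝ such that dist(q, q') = |x(q) − x(q')| for all q, q' ∈ Q. Let ε > 0 be a real number. Then for every vertex v ∈ X there exists a set C(v) ⊆ Q with cardinality at most 2·(1 + 2/ε) such that the following holds for all u, w ∈ X: (i) for all c, c' ∈ Q, dist(u, c) + dist(c, c') + dist(c', w) ≥ dist(u, w); and (ii) if there exists q ∈ Q with dist(u, q) + dist(q, w) = dist(u, w) (a shortest u-to-w path intersects Q), then there exist c ∈ C(u) and c' ∈ C(w) with dist(u, c) + dist(c, c') + dist(c', w) ≤ (1+ε)·dist(u, w). -/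
theorem side_aux {X : Type*} (D x : X → ℝ) (ε d L : ℝ) (hε : 0 < ε) (hd : 0 ≤ d) (n : ℕ) :
    ∀ S : Finset X, S.card ≤ n → (∀ s ∈ S, d ≤ D s) → (∀ s ∈ S, L ≤ D s - x s) →
      ∀ c ∈ S, (∀ s ∈ S, x c ≤ x s) →
      ∃ C : Finset X, C ⊆ S ∧ (C.card : ℝ) * (ε * d) ≤ ε * d + (D c - x c - L) ∧
        ∀ q ∈ S, ∃ a ∈ C, x a ≤ x q ∧ D a + (x q - x a) ≤ (1 + ε) * D q := by
  classical
  induction n with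
  | zero =>
    intro S hS _ _ c hc
    have : S = ∅ := by simpa using hS
    simp [this] at hc
  | succ n ih =>
    intro S hS hD hL c hc hmin
    set B := S.filter (fun q => (1 + ε) * D q < D c + (x q - x c)) with hB
    have hBS : B ⊆ S := Finset.filter_subset _ _
    have hcB : c ∉ B := by
      simp only [hB, Finset.mem_filter, not_and, not_lt]
      intro _
      nlinarith [hD c hc, mul_nonneg hε.le (hd.trans (hD c hc))]
    rcases B.eq_empty_or_nonempty with h0 | hne
    · refine ⟨{c}, by simpa using hc, ?_, ?_⟩
      · have := hL c hc
        simp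
        linarith
      · intro q hq
        refine ⟨c, by simp, hmin q hq, ?_⟩
        by_contra h
        have : q ∈ B := by
          simp only [hB, Finset.mem_filter]
          exact ⟨hq, not_le.mp h⟩
        simp [h0] at this
    · obtain ⟨b, hb, hbmin⟩ := B.exists_min_image x hne
      have hcard : B.card < S.card := Finset.card_lt_card
        ⟨hBS, fun h => hcB (h hc)⟩
      obtain ⟨C, hCB, hC, hcov⟩ := ih B (by omega) (fun s hs => hD s (hBS hs))
        (fun s hs => hL s (hBS hs)) b hb hbmin
      refine ⟨insert c C, ?_, ?_, ?_⟩
      · exact Finset.insert_subset hc (hCB.trans hBS)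
      · have h1 : ((insert c C).card : ℝ) ≤ C.card + 1 := by
          exact_mod_cast Finset.card_insert_le c C
        have h2 := (Finset.mem_filter.mp hb).2
        have h3 := mul_le_mul_of_nonneg_right h1 (mul_nonneg hε.le hd)
        have h4 := mul_le_mul_of_nonneg_left (hD b (hBS hb)) hε.le
        nlinarith
      · intro q hq
        by_cases h : q ∈ B
        · obtain ⟨a, ha, h⟩ := hcov q h
          exact ⟨a, Finset.mem_insert_of_mem ha, h⟩
        · refine ⟨c, Finset.mem_insert_self _ _, hmin q hq, ?_⟩
          by_contra h'
          exact h (Finset.mem_filter.mpr ⟨hq, not_le.mp h'⟩)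

theorem single_aux {X : Type*} [PseudoMetricSpace X]
    (Q : Finset X) (x : X → ℝ)
    (hx : ∀ q ∈ Q, ∀ q' ∈ Q, dist q q' = |x q - x q'|)
    (ε : ℝ) (hε : 0 < ε) (v : X) :
    ∃ C : Finset X, (C ⊆ Q ∧ (C.card : ℝ) ≤ 2 * (1 + 2 / ε)) ∧
      ∀ q ∈ Q, ∃ c ∈ C, dist v c + dist c q ≤ (1 + ε) * dist v q := by
  classical
  have hε2 : 0 < 2 / ε := by positivity
  rcases Q.eq_empty_or_nonempty with h0 | hne
  · refine ⟨∅, ⟨by simp, ?_⟩, by simp [h0]⟩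
    simp
    linarith
  obtain ⟨p, hp, hpm⟩ := Q.exists_min_image (fun q => dist v q) hne
  rcases (dist_nonneg (x := v) (y := p)).eq_or_lt with hd | hd
  · refine ⟨{p}, ⟨by simpa using hp, ?_⟩, ?_⟩
    · simp
      linarith
    · intro q hq
      refine ⟨p, by simp, ?_⟩
      have := dist_triangle_left p q v
      have := mul_nonneg hε.le (dist_nonneg (x := v) (y := q))
      linarith
  have key : ∀ y : X → ℝ, (∀ q ∈ Q, ∀ q' ∈ Q, dist q q' = |y q - y q'|) →
      ∃ C : Finset X, C ⊆ Q ∧ (C.card : ℝ) ≤ 1 + 2 / ε ∧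
        ∀ q ∈ Q, y p ≤ y q → ∃ c ∈ C, dist v c + dist c q ≤ (1 + ε) * dist v q := by
    intro y hy
    obtain ⟨C, hCS, hC, hcov⟩ := side_aux (fun q => dist v q) y ε (dist v p)
      (-dist v p - y p) hε hd.le _ (Q.filter (fun q => y p ≤ y q)) le_rfl
      (fun s hs => hpm s (Finset.mem_filter.mp hs).1)
      (fun s hs => by
        have h1 := dist_triangle_left p s v
        rw [hy p hp s (Finset.mem_filter.mp hs).1] at h1
        have := neg_abs_le (y p - y s)
        linarith)
      p (by simp [hp]) (fun s hs => (Finset.mem_filter.mp hs).2)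
    have hCQ := hCS.trans (Finset.filter_subset _ _)
    refine ⟨C, hCQ, ?_, ?_⟩
    · have h : (C.card : ℝ) * (ε * dist v p) ≤ (1 + 2 / ε) * (ε * dist v p) := by
        have : (1 + 2 / ε) * (ε * dist v p) = ε * dist v p + 2 * dist v p := by
          field_simp
        rw [this]
        linarith
      exact le_of_mul_le_mul_right h (by positivity)
    · intro q hq hpq
      obtain ⟨a, ha, h1, h2⟩ := hcov q (by simp [hq, hpq])
      refine ⟨a, ha, ?_⟩
      rw [hy a (hCQ ha) q hq, abs_sub_comm, abs_of_nonneg (by linarith)]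
      exact h2
  obtain ⟨A, hA, hA1, hA2⟩ := key x hx
  obtain ⟨B, hB, hB1, hB2⟩ := key (fun q => - x q) (fun q hq q' hq' => by
    rw [hx q hq q' hq', abs_sub_comm]
    congr 1
    ring)
  refine ⟨A ∪ B, ⟨Finset.union_subset hA hB, ?_⟩, ?_⟩
  · have : ((A ∪ B).card : ℝ) ≤ A.card + B.card := by exact_mod_cast Finset.card_union_le A B
    linarith
  · intro q hq
    rcases le_total (x p) (x q) with h | h
    · obtain ⟨c, hc, h⟩ := hA2 q hq h
      exact ⟨c, Finset.mem_union_left _ hc, h⟩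
    · obtain ⟨c, hc, h⟩ := hB2 q hq (neg_le_neg h)
      exact ⟨c, Finset.mem_union_right _ hc, h⟩

theorem connections_lemma
    {X : Type*} [PseudoMetricSpace X]
    (Q : Finset X) (x : X → ℝ)
    (hx : ∀ q ∈ Q, ∀ q' ∈ Q, dist q q' = |x q - x q'|)
    (ε : ℝ) (hε : 0 < ε) :
    ∃ C : X → Finset X,
      (∀ v : X, C v ⊆ Q ∧ ((C v).card : ℝ) ≤ 2 * (1 + 2 / ε)) ∧
      ∀ u w : X,
        (∀ c ∈ Q, ∀ c' ∈ Q, dist u w ≤ dist u c + dist c c' + dist c' w) ∧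
        ((∃ q ∈ Q, dist u q + dist q w = dist u w) →
          ∃ c ∈ C u, ∃ c' ∈ C w,
            dist u c + dist c c' + dist c' w ≤ (1 + ε) * dist u w) := by
  choose C hC hcov using single_aux Q x hx ε hε
  refine ⟨C, hC, fun u w => ⟨fun c _ c' _ => dist_triangle4 u c c' w, ?_⟩⟩
  rintro ⟨q, hq, h⟩
  obtain ⟨c, hc, h1⟩ := hcov u q hq
  obtain ⟨c', hc', h2⟩ := hcov w q hq
  refine ⟨c, hc, c', hc', ?_⟩
  have h3 := dist_triangle_right c c' q
  rw [← h, mul_add, dist_comm q w, dist_comm c' w]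
  linarith
end

section
/- Let (X, dist) be a pseudometric space, let ε ≥ 0, let u ∈ X, and let S ⊆ X be a finite nonempty set (the vertices carrying label λ); write dist(q, S) for the minimum of dist(q, s) over s ∈ S. Suppose q ∈ X and s ∈ S satisfy dist(u, q) + dist(q, s) = dist(u, S) (a shortest path from u to its nearest λ-labeled vertex passes through q). Let C_u ⊆ X and ℓ_u : X → ℝ satisfy ℓ_u(c) ≥ dist(u, c) for all c ∈ C_u, with some c ∈ C_u satisfying ℓ_u(c) + dist(c, q) ≤ (1+ε)·dist(u, q); and let C_λ ⊆ X and ℓ_λ : X → ℝ satisfy ℓ_λ(c') ≥ dist(c', S) for all c' ∈ C_λ, with some c' ∈ C_λ satisfying ℓ_λ(c') + dist(c', q) ≤ (1+ε)·dist(q, S). Then the minimum over c ∈ C_u and c' ∈ C_λ of ℓ_u(c) + dist(c, c') + ℓ_λ(c') is at least dist(u, S) and at most (1+ε)·dist(u, S). -/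
theorem vertex_label_query_correctness
    {X : Type*} [PseudoMetricSpace X]
    (ε : ℝ) (hε : 0 ≤ ε) (u : X)
    (S : Finset X) (hS : S.Nonempty)
    (q : X) (s : X) (hs : s ∈ S)
    (hq : dist u q + dist q s = S.inf' hS (fun t => dist u t))
    (Cu CL : Set X) (ℓu ℓL : X → ℝ)
    (hℓu : ∀ c ∈ Cu, dist u c ≤ ℓu c)
    (hcu : ∃ c ∈ Cu, ℓu c + dist c q ≤ (1 + ε) * dist u q)
    (hℓL : ∀ c' ∈ CL, S.inf' hS (fun t => dist c' t) ≤ ℓL c')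
    (hcL : ∃ c' ∈ CL, ℓL c' + dist c' q ≤
      (1 + ε) * S.inf' hS (fun t => dist q t)) :
    (∀ c ∈ Cu, ∀ c' ∈ CL,
      S.inf' hS (fun t => dist u t) ≤ ℓu c + dist c c' + ℓL c') ∧
    (∃ c ∈ Cu, ∃ c' ∈ CL,
      ℓu c + dist c c' + ℓL c' ≤ (1 + ε) * S.inf' hS (fun t => dist u t)) := by
  constructor
  · intro c hc c' hc'
    obtain ⟨t, ht, hte⟩ := Finset.exists_mem_eq_inf' hS (fun t => dist c' t)
    have h1 := hℓu c hc
    have h2 := hℓL c' hc'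
    rw [hte] at h2
    have h3 : S.inf' hS (fun t => dist u t) ≤ dist u t :=
      Finset.inf'_le (fun t => dist u t) ht
    have h4 := dist_triangle4 u c c' t
    linarith
  · obtain ⟨c, hc, h1⟩ := hcu
    obtain ⟨c', hc', h2⟩ := hcL
    refine ⟨c, hc, c', hc', ?_⟩
    have h3 : S.inf' hS (fun t => dist q t) ≤ dist q s :=
      Finset.inf'_le (fun t => dist q t) hs
    have h4 := dist_triangle_right c c' q
    have h5 := mul_le_mul_of_nonneg_left h3 (by linarith : (0 : ℝ) ≤ 1 + ε)
    rw [← hq, mul_add]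
    linarith
end

section
/- Let α > 0 and ε > 0 be real numbers, let Q be a finite set with an injective map x : Q → ℝ with 0 ≤ x(q) ≤ α for all q ∈ Q (positions along a directed shortest path of length at most α), and let h : Q → ℝ satisfy 0 ≤ h(q) ≤ α for all q ∈ Q and h(q') ≤ h(q) + (x(q') − x(q)) whenever x(q) ≤ x(q') (the triangle inequality for the distances h from a fixed vertex to the vertices of the path). Then there exists C ⊆ Q with cardinality at most 1 + 2/ε such that for every q ∈ Q there is c ∈ C with x(c) ≤ x(q) and h(c) + (x(q) − x(c)) ≤ h(q) + ε·α. -/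
theorem directed_connections_exist
    (α ε : ℝ) (hα : 0 < α) (hε : 0 < ε)
    {Q : Type*} [Fintype Q]
    (x : Q → ℝ) (hxinj : Function.Injective x)
    (hx0 : ∀ q : Q, 0 ≤ x q) (hx1 : ∀ q : Q, x q ≤ α)
    (h : Q → ℝ)
    (hh0 : ∀ q : Q, 0 ≤ h q) (hh1 : ∀ q : Q, h q ≤ α)
    (htri : ∀ q q' : Q, x q ≤ x q' → h q' ≤ h q + (x q' - x q)) :
    ∃ C : Finset Q, (C.card : ℝ) ≤ 1 + 2 / ε ∧
      ∀ q : Q, ∃ c ∈ C, x c ≤ x q ∧ h c + (x q - x c) ≤ h q + ε * α := by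
  classical
  have hεα : 0 < ε * α := mul_pos hε hα
  obtain ⟨b, hb⟩ : ∃ b : Q → ℕ, ∀ q, b q = ⌊(α - (h q - x q)) / (ε * α)⌋₊ :=
    ⟨_, fun _ => rfl⟩
  have hex : ∀ q, ∃ c, b c = b q ∧ ∀ r, b r = b q → x c ≤ x r := by
    intro q
    obtain ⟨c, hc, hm⟩ := Finset.exists_min_image
      (Finset.univ.filter (fun r => b r = b q)) x ⟨q, by simp⟩
    refine ⟨c, by simpa using hc, fun r hr => hm r (by simpa using hr)⟩
  choose g hg1 hg2 using hex
  have hnn : ∀ q, 0 ≤ (α - (h q - x q)) / (ε * α) := fun q =>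
    div_nonneg (by linarith [hh1 q, hx0 q]) hεα.le
  refine ⟨Finset.univ.image g, ?_, fun q => ⟨g q, by simp, hg2 q q rfl, ?_⟩⟩
  · have hcard : (Finset.univ.image g).card ≤ (Finset.range (⌊2 / ε⌋₊ + 1)).card := by
      apply Finset.card_le_card_of_injOn b
      · intro c _
        simp only [Finset.coe_range, Set.mem_Iio, Nat.lt_succ_iff, hb]
        apply Nat.floor_le_floor
        rw [div_le_div_iff₀ hεα hε]
        nlinarith [hh0 c, hx1 c]
      · intro c hc d hd hcd
        simp only [Finset.coe_image, Finset.coe_univ, Set.image_univ, Set.mem_range] at hc hd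
        obtain ⟨p, rfl⟩ := hc
        obtain ⟨q, rfl⟩ := hd
        apply hxinj
        apply le_antisymm
        · exact hg2 p _ (hcd.symm.trans (hg1 p))
        · exact hg2 q _ (hcd.trans (hg1 q))
    rw [Finset.card_range] at hcard
    have h1 : ((Finset.univ.image g).card : ℝ) ≤ (⌊2 / ε⌋₊ : ℝ) + 1 := by exact_mod_cast hcard
    have h2 := Nat.floor_le (show 0 ≤ 2 / ε by positivity)
    linarith
  · have h1 := Nat.floor_le (hnn (g q))
    have h2 := Nat.lt_floor_add_one ((α - (h q - x q)) / (ε * α))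
    rw [← hb] at h1 h2
    rw [hg1] at h1
    rw [le_div_iff₀ hεα] at h1
    rw [div_lt_iff₀ hεα] at h2
    linarith
end
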